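/- Let X be a compact Polish metric space, Y a compact Polish space, and M : Y → 2^{P(X)} such that Gr(M) := {(y,μ) ∈ Y × P(X) : μ ∈ M(y)} is closed and M(y) is convex for every y. Equip Y with the σ-algebra of universally measurable sets (sets measurable with respect to the completion of every Borel probability measure on Y) and C(P(X) × X) with the Borel σ-algebra of the sup-norm topology. Then for every ε > 0 there exists a measurable map S^ε : Y → C(P(X) × X) such that for every y ∈ Y, S^ε(y) is (M(y), ε)-savvy. -/

import Mathlib

open MeasureTheory Filter Set Topology
open scoped NNReal ENNReal

noncomputable section

/-- The completion of the ambient σ-algebra with respect to a measure `μ`: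
the σ-algebra of `μ`-null-measurable sets. -/
def completionMS {Y : Type*} [MeasurableSpace Y] (μ : Measure Y) : MeasurableSpace Y where
  MeasurableSet' s := NullMeasurableSet s μ
  measurableSet_empty := MeasurableSet.empty.nullMeasurableSet
  measurableSet_compl := fun _ h => h.compl
  measurableSet_iUnion := fun _ h => NullMeasurableSet.iUnion h

/-- The σ-algebra of universally measurable sets: the intersection of the completions
of the ambient (Borel) σ-algebra with respect to all probability measures. -/
def univMS (Y : Type*) [MeasurableSpace Y] : MeasurableSpace Y :=
  ⨅ (μ : Measure Y) (_ : IsProbabilityMeasure μ), completionMS μ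

/-- The support of a probability measure: the set of points all of whose open
neighbourhoods have positive measure. -/
def msupp {X : Type*} [TopologicalSpace X] [MeasurableSpace X] (μ : ProbabilityMeasure X) :
    Set X :=
  {x | ∀ U : Set X, IsOpen U → x ∈ U → 0 < μ.toMeasure U}

/-- `ρ` is a metrization of the topological space `X`: it is a metric and the
neighbourhood filters are generated by its open balls. -/
structure IsMetrization {X : Type*} [TopologicalSpace X] (ρ : X → X → ℝ) : Prop where
  refl : ∀ x, ρ x x = 0
  pos : ∀ x y, x ≠ y → 0 < ρ x y
  symm : ∀ x y, ρ x y = ρ y x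
  triangle : ∀ x y z, ρ x z ≤ ρ x y + ρ y z
  nhds_basis : ∀ x : X, (nhds x).HasBasis (fun ε : ℝ => 0 < ε) (fun ε => {y | ρ x y < ε})

/-- `f` is Lipschitz with respect to the metric `ρ`. -/
def LipWrt {X : Type*} (ρ : X → X → ℝ) (f : X → ℝ) : Prop :=
  ∃ K : ℝ, ∀ x y, |f x - f y| ≤ K * ρ x y

/-- The norm `‖f‖_ρ := max_x |f x| + sup_{x ≠ y} |f x - f y| / ρ x y` on Lipschitz functions. -/
def lipNorm {X : Type*} (ρ : X → X → ℝ) (f : X → ℝ) : ℝ :=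
  (⨆ x, |f x|) + sSup {c | ∃ x y, x ≠ y ∧ c = |f x - f y| / ρ x y}

/-- The Kantorovich-Rubinstein distance
`D^ρ(μ, ν) := sup {E_μ[f] - E_ν[f] | f Lipschitz, ‖f‖_ρ ≤ 1}`. -/
def KRdist {X : Type*} [MeasurableSpace X] (ρ : X → X → ℝ) (μ ν : ProbabilityMeasure X) : ℝ :=
  sSup {c | ∃ f : X → ℝ, LipWrt ρ f ∧ lipNorm ρ f ≤ 1 ∧
    c = (∫ x, f x ∂(μ : Measure X)) - ∫ x, f x ∂(ν : Measure X)}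

/-- The Kantorovich-Rubinstein distance from a measure to a set of measures. -/
def KRdistSet {X : Type*} [MeasurableSpace X] (ρ : X → X → ℝ) (μ : ProbabilityMeasure X)
    (A : Set (ProbabilityMeasure X)) : ℝ :=
  sInf {c | ∃ ν ∈ A, c = KRdist ρ μ ν}

/-- Convexity for a set of probability measures. -/
def ConvexPM {X : Type*} [MeasurableSpace X] (A : Set (ProbabilityMeasure X)) : Prop :=
  ∀ μ ∈ A, ∀ ν ∈ A, ∀ p : ℝ≥0, p ≤ 1 → ∀ ξ : ProbabilityMeasure X,
    (ξ : Measure X) = p • (μ : Measure X) + (1 - p) • (ν : Measure X) → ξ ∈ A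

/-- `κ` is a regular conditional probability for `μ` given `π`: it is a measurable family
of probability measures which disintegrates `μ` over `π_* μ` and is concentrated on fibers. -/
def IsRCP {X Y : Type*} [MeasurableSpace X] [MeasurableSpace Y]
    (μ : Measure X) (π : X → Y) (κ : Y → ProbabilityMeasure X) : Prop :=
  Measurable (fun y => (κ y : Measure X)) ∧
  (∀ s : Set X, MeasurableSet s → ∀ t : Set Y, MeasurableSet t →
    μ (s ∩ π ⁻¹' t) = ∫⁻ y in t, (κ y : Measure X) s ∂(μ.map π)) ∧
  (∀ᵐ y ∂(μ.map π), (κ y : Measure X) (π ⁻¹' {y}) = 1)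

/-- `N` is a regular upper bound for `M | π` (Definition 2.2 of the paper). -/
structure IsRUB {X Y : Type*} [TopologicalSpace X] [TopologicalSpace Y]
    [MeasurableSpace X] [MeasurableSpace Y] [OpensMeasurableSpace X]
    (π : X → Y) (M : Set (ProbabilityMeasure X)) (N : Y → Set (ProbabilityMeasure X)) : Prop where
  closed : IsClosed {p : Y × ProbabilityMeasure X | p.2 ∈ N p.1}
  convex : ∀ y, ConvexPM (N y)
  cond : ∀ μ ∈ M, ∀ κ : Y → ProbabilityMeasure X, IsRCP (μ : Measure X) π κ →
    ∀ᵐ y ∂((μ : Measure X).map π), κ y ∈ N y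

/-- `β` is an `(M, r₀)`-savvy bet (with respect to the metric `ρ`). -/
def IsSavvy {X : Type*} [TopologicalSpace X] [MeasurableSpace X] [OpensMeasurableSpace X]
    (ρ : X → X → ℝ) (M : Set (ProbabilityMeasure X)) (r₀ : ℝ)
    (β : ProbabilityMeasure X × X → ℝ) : Prop :=
  Continuous β ∧
  ∀ μ : ProbabilityMeasure X,
    (∀ x, |β (μ, x)| ≤ max (KRdistSet ρ μ M - r₀) 0) ∧
    ∀ ν ∈ M, (1/2) * (KRdistSet ρ μ M - r₀) * KRdistSet ρ μ M ≤
      (∫ x, β (μ, x) ∂(ν : Measure X)) - ∫ x, β (μ, x) ∂(μ : Measure X)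

/-- Borel σ-algebra on the space of probability measures (with its weak topology). -/
instance {X : Type*} [TopologicalSpace X] [MeasurableSpace X] [OpensMeasurableSpace X] :
    MeasurableSpace (ProbabilityMeasure X) := borel _

/-- Borel σ-algebra on a space of continuous functions. -/
instance {Y : Type*} [TopologicalSpace Y] : MeasurableSpace C(Y, ℝ) := borel _

end

instance {K : Type*} [TopologicalSpace K] : BorelSpace C(K, ℝ) := ⟨rfl⟩

/-- Every Borel set is universally measurable. -/
theorem le_univMS (Y : Type*) [m : MeasurableSpace Y] : m ≤ univMS Y :=
  le_iInf₂ fun _ _ _ hs => hs.nullMeasurableSet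

/-- A map into `C(K, ℝ)` is Borel measurable as soon as all its evaluations are. -/
theorem ContinuousMap.measurable_of_measurable_eval {Ω K : Type*} [MeasurableSpace Ω]
    [TopologicalSpace K] [CompactSpace K] [TopologicalSpace.MetrizableSpace K]
    {F : Ω → C(K, ℝ)} (hF : ∀ k, Measurable fun ω => F ω k) : Measurable F := by
  have ball : ∀ (f : C(K, ℝ)) (r : ℝ), 0 ≤ r →
      MeasurableSet (F ⁻¹' Metric.closedBall f r) := by
    intro f r hr
    let _ := TopologicalSpace.metrizableSpaceMetric K
    obtain ⟨s, hsc, hsd⟩ := TopologicalSpace.exists_countable_dense K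
    have : F ⁻¹' Metric.closedBall f r = ⋂ k ∈ s, {ω | dist (F ω k) (f k) ≤ r} := by
      ext ω
      simp only [mem_preimage, Metric.mem_closedBall, ContinuousMap.dist_le hr, mem_iInter]
      refine ⟨fun h k _ => h k, fun h k => ?_⟩
      have hcl : IsClosed {k | dist (F ω k) (f k) ≤ r} :=
        isClosed_le (by fun_prop) continuous_const
      have := hcl.closure_subset_iff.2 (fun k hk => h k hk : s ⊆ _)
      exact this (hsd k)
    rw [this]
    exact MeasurableSet.biInter hsc fun k _ =>
      measurableSet_le ((hF k).dist measurable_const) measurable_const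
  refine measurable_of_isOpen fun U hU => ?_
  have hball : ∀ f : U, ∃ r > 0, Metric.closedBall (f : C(K, ℝ)) r ⊆ U := fun f =>
    Metric.nhds_basis_closedBall.mem_iff.1 (hU.mem_nhds f.2)
  choose r hr hrU using hball
  obtain ⟨T, hT, hTU⟩ := TopologicalSpace.isOpen_iUnion_countable
    (fun f : U => Metric.ball (f : C(K, ℝ)) (r f)) fun _ => Metric.isOpen_ball
  have : U = ⋃ f ∈ T, Metric.closedBall (f : C(K, ℝ)) (r f) := by
    refine Subset.antisymm (fun f hf => ?_) (iUnion₂_subset fun f _ => hrU f)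
    have h1 : f ∈ ⋃ f : U, Metric.ball (f : C(K, ℝ)) (r f) :=
      mem_iUnion.2 ⟨⟨f, hf⟩, Metric.mem_ball_self (hr _)⟩
    rw [← hTU] at h1
    exact iUnion₂_mono (fun f _ => Metric.ball_subset_closedBall) h1
  rw [this, preimage_iUnion₂]
  exact MeasurableSet.biUnion hT fun f _ => ball _ _ (hr f).le

section LipBall

variable {X : Type*} [MetricSpace X]

variable (X) in
/-- The unit ball of the norm `‖f‖_ρ`, inside the continuous functions. -/
def lipBall : Set C(X, ℝ) :=
  {f | ∃ p : Icc (0 : ℝ) 1 × Icc (0 : ℝ) 1, (p.1 : ℝ) + p.2 ≤ 1 ∧ (∀ x, |f x| ≤ p.1) ∧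
    ∀ x y, |f x - f y| ≤ p.2 * dist x y}

theorem zero_mem_lipBall : (0 : C(X, ℝ)) ∈ lipBall X :=
  ⟨(0, 0), by simp, by simp, by simp⟩

theorem neg_mem_lipBall {f : C(X, ℝ)} (hf : f ∈ lipBall X) : -f ∈ lipBall X := by
  obtain ⟨p, h1, h2, h3⟩ := hf
  refine ⟨p, h1, by simpa using h2, fun x y => ?_⟩
  have := h3 y x
  rw [dist_comm] at this
  convert this using 2
  simp
  ring

theorem norm_le_one_of_mem_lipBall [CompactSpace X] {f : C(X, ℝ)} (hf : f ∈ lipBall X) : ‖f‖ ≤ 1 := by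
  obtain ⟨p, _, h2, _⟩ := hf
  exact (ContinuousMap.norm_le _ zero_le_one).2 fun x => (h2 x).trans p.1.2.2

theorem convex_lipBall : Convex ℝ (lipBall X) := by
  rintro f ⟨p, hp1, hp2, hp3⟩ g ⟨q, hq1, hq2, hq3⟩ a b ha hb hab
  refine ⟨(⟨a * p.1 + b * q.1, ?_⟩, ⟨a * p.2 + b * q.2, ?_⟩), ?_, fun x => ?_, fun x y => ?_⟩
  · exact (convex_Icc (0 : ℝ) 1) p.1.2 q.1.2 ha hb hab
  · exact (convex_Icc (0 : ℝ) 1) p.2.2 q.2.2 ha hb hab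
  · simp only
    nlinarith
  · have h1 := mul_le_mul_of_nonneg_left (hp2 x) ha
    have h2 := mul_le_mul_of_nonneg_left (hq2 x) hb
    calc |(a • f + b • g) x| = |a * f x + b * g x| := by simp
      _ ≤ |a * f x| + |b * g x| := abs_add_le _ _
      _ ≤ _ := by rw [abs_mul, abs_mul, abs_of_nonneg ha, abs_of_nonneg hb]; exact add_le_add h1 h2
  · have h1 := mul_le_mul_of_nonneg_left (hp3 x y) ha
    have h2 := mul_le_mul_of_nonneg_left (hq3 x y) hb
    calc |(a • f + b • g) x - (a • f + b • g) y|
        = |a * (f x - f y) + b * (g x - g y)| := by congr 1; simp; ring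
      _ ≤ |a * (f x - f y)| + |b * (g x - g y)| := abs_add_le _ _
      _ = a * |f x - f y| + b * |g x - g y| := by
        rw [abs_mul, abs_mul, abs_of_nonneg ha, abs_of_nonneg hb]
      _ ≤ (a * p.2 + b * q.2) * dist x y := by linarith

theorem isCompact_lipBall [CompactSpace X] : IsCompact (lipBall X) := by
  have hclosed : IsClosed (lipBall X) := by
    have : lipBall X = Prod.snd '' {q : (Icc (0 : ℝ) 1 × Icc (0 : ℝ) 1) × C(X, ℝ) |
        (q.1.1 : ℝ) + q.1.2 ≤ 1 ∧ (∀ x, |q.2 x| ≤ q.1.1) ∧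
          ∀ x y, |q.2 x - q.2 y| ≤ q.1.2 * dist x y} := by
      ext f
      constructor
      · rintro ⟨p, hp⟩
        exact ⟨(p, f), hp, rfl⟩
      · rintro ⟨⟨p, f⟩, hp, rfl⟩
        exact ⟨p, hp⟩
    rw [this]
    refine isClosedMap_snd_of_compactSpace _ ?_
    simp only [ofPred_and, ofPred_forall]
    refine (isClosed_le (by fun_prop) continuous_const).inter (IsClosed.inter ?_ ?_)
    · exact isClosed_iInter fun x => isClosed_le (by fun_prop) (by fun_prop)
    · exact isClosed_iInter fun x => isClosed_iInter fun y =>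
        isClosed_le (by fun_prop) (by fun_prop)
  let e := (ContinuousMap.isometryEquivBoundedOfCompact X ℝ).toHomeomorph
  have hc : IsCompact (e.symm ⁻¹' lipBall X) := by
    refine BoundedContinuousFunction.arzela_ascoli₂ (Icc (-1) 1) isCompact_Icc _
      (hclosed.preimage e.symm.continuous) ?_ ?_
    · rintro f x ⟨p, _, h2, _⟩
      exact abs_le.1 ((h2 x).trans p.1.2.2)
    · refine Metric.equicontinuous_of_continuity_modulus (fun t => t) tendsto_id _ ?_
      rintro x y ⟨f, p, _, _, h3⟩
      refine (h3 x y).trans ?_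
      have := p.2.2.2
      nlinarith [dist_nonneg (x := x) (y := y)]
  rwa [e.symm.isCompact_preimage] at hc

theorem lipWrt_and_lipNorm_le_one_iff [CompactSpace X] [Nonempty X] (f : X → ℝ) :
    (LipWrt dist f ∧ lipNorm dist f ≤ 1) ↔ ∃ g ∈ lipBall X, ⇑g = f := by
  constructor
  · rintro ⟨⟨K, hK⟩, hn⟩
    have hf : Continuous f := by
      refine (LipschitzWith.of_dist_le_mul (K := K.toNNReal) fun x y => ?_).continuous
      exact (hK x y).trans (mul_le_mul_of_nonneg_right (Real.le_coe_toNNReal K) dist_nonneg)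
    have hbdd : BddAbove (range fun x => |f x|) := (isCompact_range hf.abs).bddAbove
    have hbdd' : BddAbove {c | ∃ x y, x ≠ y ∧ c = |f x - f y| / dist x y} := by
      refine ⟨K, ?_⟩
      rintro c ⟨x, y, hxy, rfl⟩
      exact (div_le_iff₀ (dist_pos.2 hxy)).2 (hK x y)
    have ha : 0 ≤ ⨆ x, |f x| := Real.iSup_nonneg fun x => abs_nonneg _
    have hb : 0 ≤ sSup {c | ∃ x y, x ≠ y ∧ c = |f x - f y| / dist x y} := by
      refine Real.sSup_nonneg ?_
      rintro c ⟨x, y, _, rfl⟩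
      positivity
    unfold lipNorm at hn
    refine ⟨⟨f, hf⟩, ⟨(⟨_, ha, by linarith⟩, ⟨_, hb, by linarith⟩), hn,
      fun x => le_ciSup hbdd x, fun x y => ?_⟩, rfl⟩
    rcases eq_or_ne x y with rfl | hxy
    · simp
    · exact (div_le_iff₀ (dist_pos.2 hxy)).1 (le_csSup hbdd' ⟨x, y, hxy, rfl⟩)
  · rintro ⟨g, ⟨p, h1, h2, h3⟩, rfl⟩
    refine ⟨⟨p.2, h3⟩, le_trans (add_le_add (ciSup_le h2) (Real.sSup_le ?_ p.2.2.1)) h1⟩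
    rintro c ⟨x, y, hxy, rfl⟩
    exact (div_le_iff₀ (dist_pos.2 hxy)).2 (h3 x y)

end LipBall

theorem KRdistSet_eq {X : Type*} [MetricSpace X] [MeasurableSpace X] (μ : ProbabilityMeasure X)
    (M : Set (ProbabilityMeasure X)) :
    KRdistSet dist μ M = sInf (KRdist dist μ '' M) := by
  unfold KRdistSet
  congr 1
  ext c
  simp [eq_comm]

section KantorovichRubinstein

variable {X : Type*} [MetricSpace X] [CompactSpace X] [MeasurableSpace X] [BorelSpace X]

theorem integrable_continuousMap (μ : ProbabilityMeasure X) (f : C(X, ℝ)) :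
    Integrable f (μ : Measure X) :=
  f.continuous.integrable_of_hasCompactSupport (HasCompactSupport.of_compactSpace _)

/-- The expectation of continuous functions under `μ`, as a linear form. -/
noncomputable def expectation (μ : ProbabilityMeasure X) : C(X, ℝ) →ₗ[ℝ] ℝ where
  toFun f := ∫ x, f x ∂(μ : Measure X)
  map_add' f g := integral_add (integrable_continuousMap μ f) (integrable_continuousMap μ g)
  map_smul' c _ := integral_const_mul c _

theorem expectation_apply (μ : ProbabilityMeasure X) (f : C(X, ℝ)) :
    expectation μ f = ∫ x, f x ∂(μ : Measure X) := rfl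

theorem abs_expectation_le (μ : ProbabilityMeasure X) (f : C(X, ℝ)) :
    |expectation μ f| ≤ ‖f‖ := by
  have h := norm_integral_le_of_norm_le_const (μ := (μ : Measure X)) (f := f) (C := ‖f‖)
    (Eventually.of_forall fun x => f.norm_coe_le_norm x)
  simpa [expectation_apply] using h

theorem continuous_expectation :
    Continuous fun p : ProbabilityMeasure X × C(X, ℝ) => expectation p.1 p.2 := by
  rw [continuous_iff_continuousAt]
  rintro ⟨μ, f⟩
  have h1 : Tendsto (fun p : ProbabilityMeasure X × C(X, ℝ) => expectation p.1 f)
      (𝓝 (μ, f)) (𝓝 (expectation μ f)) :=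
    ((ProbabilityMeasure.continuous_integral_continuousMap f).comp continuous_fst).tendsto (μ, f)
  have h2 : Tendsto (fun p : ProbabilityMeasure X × C(X, ℝ) => expectation p.1 (p.2 - f))
      (𝓝 (μ, f)) (𝓝 0) := by
    refine squeeze_zero_norm (fun p => abs_expectation_le p.1 (p.2 - f)) ?_
    have : Continuous fun p : ProbabilityMeasure X × C(X, ℝ) => ‖p.2 - f‖ := by fun_prop
    simpa using this.tendsto (μ, f)
  have := h1.add h2
  simpa [ContinuousAt] using this

theorem Continuous.expectation {Z : Type*} [TopologicalSpace Z] {m : Z → ProbabilityMeasure X}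
    {f : Z → C(X, ℝ)} (hm : Continuous m) (hf : Continuous f) :
    Continuous fun z => expectation (m z) (f z) :=
  continuous_expectation.comp (hm.prodMk hf)

theorem KRdist_eq (μ ν : ProbabilityMeasure X) :
    KRdist dist μ ν = sSup ((fun f => expectation μ f - expectation ν f) '' lipBall X) := by
  have := μ.nonempty
  unfold KRdist
  congr 1
  ext c
  constructor
  · rintro ⟨f, h1, h2, rfl⟩
    obtain ⟨g, hg, rfl⟩ := (lipWrt_and_lipNorm_le_one_iff f).1 ⟨h1, h2⟩
    exact ⟨g, hg, rfl⟩
  · rintro ⟨g, hg, rfl⟩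
    obtain ⟨h1, h2⟩ := (lipWrt_and_lipNorm_le_one_iff g).2 ⟨g, hg, rfl⟩
    exact ⟨g, h1, h2, rfl⟩

theorem continuous_KRdist :
    Continuous fun p : ProbabilityMeasure X × ProbabilityMeasure X => KRdist dist p.1 p.2 := by
  simp only [KRdist_eq]
  refine isCompact_lipBall.continuous_sSup
    (f := fun (p : ProbabilityMeasure X × ProbabilityMeasure X) f =>
      expectation p.1 f - expectation p.2 f) ?_
  exact (Continuous.expectation (by fun_prop) (by fun_prop)).sub
    (Continuous.expectation (by fun_prop) (by fun_prop))

theorem sub_le_KRdist (μ ν : ProbabilityMeasure X) {f : C(X, ℝ)} (hf : f ∈ lipBall X) :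
    expectation μ f - expectation ν f ≤ KRdist dist μ ν := by
  rw [KRdist_eq]
  refine le_csSup (isCompact_lipBall.bddAbove_image (Continuous.continuousOn ?_)) ⟨f, hf, rfl⟩
  exact (Continuous.expectation continuous_const continuous_id).sub
    (Continuous.expectation continuous_const continuous_id)

theorem KRdist_le {μ ν : ProbabilityMeasure X} {c : ℝ}
    (h : ∀ f ∈ lipBall X, expectation μ f - expectation ν f ≤ c) : KRdist dist μ ν ≤ c := by
  rw [KRdist_eq]
  refine csSup_le ⟨_, 0, zero_mem_lipBall, rfl⟩ ?_
  rintro _ ⟨f, hf, rfl⟩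
  exact h f hf

theorem KRdist_nonneg (μ ν : ProbabilityMeasure X) : 0 ≤ KRdist dist μ ν := by
  simpa using sub_le_KRdist μ ν zero_mem_lipBall

theorem KRdist_self (μ : ProbabilityMeasure X) : KRdist dist μ μ = 0 :=
  le_antisymm (KRdist_le fun _ _ => by simp) (KRdist_nonneg μ μ)

theorem expectation_eq_of_KRdist_eq_zero {μ ν : ProbabilityMeasure X}
    (h : KRdist dist μ ν = 0) {f : C(X, ℝ)} (hf : f ∈ lipBall X) :
    expectation μ f = expectation ν f := by
  have h1 := sub_le_KRdist μ ν hf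
  have h2 := sub_le_KRdist μ ν (neg_mem_lipBall hf)
  simp only [map_neg] at h2
  linarith

theorem KRdistSet_nonneg (μ : ProbabilityMeasure X) (M : Set (ProbabilityMeasure X)) :
    0 ≤ KRdistSet dist μ M := by
  rw [KRdistSet_eq]
  refine Real.sInf_nonneg ?_
  rintro _ ⟨ν, _, rfl⟩
  exact KRdist_nonneg μ ν

theorem KRdistSet_le (μ : ProbabilityMeasure X) {M : Set (ProbabilityMeasure X)}
    {ν : ProbabilityMeasure X} (hν : ν ∈ M) : KRdistSet dist μ M ≤ KRdist dist μ ν := by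
  rw [KRdistSet_eq]
  refine csInf_le ⟨0, ?_⟩ ⟨ν, hν, rfl⟩
  rintro _ ⟨ν, _, rfl⟩
  exact KRdist_nonneg μ ν

theorem KRdistSet_eq_zero_of_mem {M : Set (ProbabilityMeasure X)} {ν : ProbabilityMeasure X}
    (hν : ν ∈ M) : KRdistSet dist ν M = 0 :=
  le_antisymm ((KRdistSet_le ν hν).trans (KRdist_self ν).le) (KRdistSet_nonneg ν M)

theorem continuous_KRdistSet {M : Set (ProbabilityMeasure X)} (hM : IsCompact M) :
    Continuous fun μ => KRdistSet dist μ M := by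
  simp only [KRdistSet_eq]
  exact hM.continuous_sInf (f := fun μ ν => KRdist dist μ ν) continuous_KRdist

theorem exists_KRdist_eq_KRdistSet {M : Set (ProbabilityMeasure X)} (hM : IsCompact M)
    (hne : M.Nonempty) (μ : ProbabilityMeasure X) :
    ∃ ν ∈ M, KRdist dist μ ν = KRdistSet dist μ M := by
  obtain ⟨ν, hν, h⟩ := hM.exists_sInf_image_eq hne
    (f := fun ν => KRdist dist μ ν)
    (continuous_KRdist.comp (continuous_const.prodMk continuous_id)).continuousOn
  exact ⟨ν, hν, by rw [KRdistSet_eq, ← h]⟩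

theorem ConvexPM.convex_image_expectation {M : Set (ProbabilityMeasure X)} (hM : ConvexPM M)
    {ι : Type*} (f : ι → C(X, ℝ)) (c : ι → ℝ) :
    Convex ℝ ((fun ν i => expectation ν (f i) - c i) '' M) := by
  rintro _ ⟨ν, hν, rfl⟩ _ ⟨ν', hν', rfl⟩ a b ha hb hab
  obtain ⟨p, rfl⟩ : ∃ p : ℝ≥0, (p : ℝ) = a := ⟨⟨a, ha⟩, rfl⟩
  have hp : p ≤ 1 := by
    rw [← NNReal.coe_le_coe]; push_cast; linarith
  obtain rfl : b = ((1 - p : ℝ≥0) : ℝ) := by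
    rw [NNReal.coe_sub hp]; push_cast; linarith
  let ξ : ProbabilityMeasure X :=
    ⟨p • (ν : Measure X) + (1 - p) • (ν' : Measure X), ⟨by
      simp only [Measure.add_apply, Measure.smul_apply, measure_univ]
      rw [← add_smul, add_tsub_cancel_of_le hp, one_smul]⟩⟩
  refine ⟨ξ, hM ν hν ν' hν' p hp ξ rfl, ?_⟩
  funext i
  have : expectation ξ (f i) =
      p * expectation ν (f i) + ((1 - p : ℝ≥0) : ℝ) * expectation ν' (f i) := by
    change ∫ x, f i x ∂(p • (ν : Measure X) + (1 - p) • (ν' : Measure X)) = _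
    rw [integral_add_measure (integrable_continuousMap ν _).smul_measure_nnreal
      (integrable_continuousMap ν' _).smul_measure_nnreal, integral_smul_nnreal_measure,
      integral_smul_nnreal_measure]
    rfl
  simp only [Pi.add_apply, Pi.smul_apply, smul_eq_mul, this]
  linear_combination c i * hab

/-- Minimax: if every element of the compact convex set `M` is at distance more than `c` from
`μ`, then a single function of the unit ball separates `μ` from all of `M` by at least `c`. -/
theorem exists_separating_mem_lipBall {M : Set (ProbabilityMeasure X)} (hM : IsCompact M)
    (hconv : ConvexPM M) {μ : ProbabilityMeasure X} {c : ℝ}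
    (hc : ∀ ν ∈ M, c < KRdist dist μ ν) :
    ∃ f ∈ lipBall X, ∀ ν ∈ M, c ≤ expectation ν f - expectation μ f := by
  classical
  by_contra! hcon
  obtain ⟨ν₀, hν₀, -⟩ := hcon 0 zero_mem_lipBall
  have key : (M ∩ ⋂ f : lipBall X,
      {ν | expectation ν (f : C(X, ℝ)) - expectation μ (f : C(X, ℝ)) ≤ c}).Nonempty := by
    refine hM.inter_iInter_nonempty _ (fun f => isClosed_le
      ((Continuous.expectation continuous_id continuous_const).sub continuous_const)
      continuous_const) fun u => ?_
    by_contra hemp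
    let Φ : ProbabilityMeasure X → (u → ℝ) := fun ν i =>
      expectation ν (i.1 : C(X, ℝ)) - expectation μ (i.1 : C(X, ℝ))
    have hdisj : Disjoint (univ.pi fun _ : u => Iio c) (Φ '' M) := by
      rw [Set.disjoint_right]
      rintro _ ⟨ν, hν, rfl⟩ hlt
      refine hemp ⟨ν, hν, ?_⟩
      simp only [mem_iInter]
      intro f hf
      exact le_of_lt (mem_Iio.1 (hlt ⟨f, hf⟩ (mem_univ _)))
    obtain ⟨φ, s, hs1, hs2⟩ := geometric_hahn_banach_open
      (convex_pi fun (_ : u) _ => convex_Iio (𝕜 := ℝ) c)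
      (isOpen_set_pi finite_univ fun _ _ => isOpen_Iio)
      (hconv.convex_image_expectation (fun i : u => (i.1 : C(X, ℝ)))
        fun i => expectation μ (i.1 : C(X, ℝ))) hdisj
    let w : u → ℝ := fun i => φ (Pi.single i 1)
    have hφ : ∀ v : u → ℝ, φ v = ∑ i, v i * w i := by
      intro v
      conv_lhs => rw [pi_eq_sum_univ' v]
      simp [w, map_sum]
    have hconst : ∀ t : ℝ, φ (fun _ => t) = t * ∑ i, w i := fun t => by
      rw [hφ, Finset.mul_sum]
    have hw : ∀ i, 0 ≤ w i := by
      intro i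
      by_contra! hneg
      obtain ⟨t, ht0, ht⟩ : ∃ t : ℝ, 0 ≤ t ∧ s ≤ φ (fun _ => c - 1) - t * w i := by
        refine ⟨max 0 ((φ (fun _ => c - 1) - s) / w i), le_max_left _ _, ?_⟩
        have := mul_le_mul_of_nonpos_right (le_max_right 0 ((φ (fun _ => c - 1) - s) / w i))
          hneg.le
        rw [div_mul_cancel₀ _ hneg.ne] at this
        linarith
      have hmem : ((fun _ => c - 1) - t • Pi.single i 1 : u → ℝ) ∈
          univ.pi fun _ : u => Iio c := by
        intro j _
        have : 0 ≤ t * (Pi.single i 1 : u → ℝ) j :=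
          mul_nonneg ht0 (by by_cases h : j = i <;> simp [h])
        simp only [Pi.sub_apply, Pi.smul_apply, smul_eq_mul, mem_Iio]
        linarith
      have := hs1 _ hmem
      rw [map_sub, map_smul, smul_eq_mul] at this
      exact absurd this (not_lt.2 ht)
    set W := ∑ i, w i with hW
    have hWpos : 0 < W := by
      refine lt_of_le_of_ne (Finset.sum_nonneg fun i _ => hw i) fun h0 => ?_
      have hw0 : ∀ i, w i = 0 := fun i =>
        (Finset.sum_eq_zero_iff_of_nonneg fun i _ => hw i).1 h0.symm i (Finset.mem_univ i)
      have h1 := hs1 (fun _ => c - 1) fun _ _ => by simp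
      have h2 := hs2 _ ⟨ν₀, hν₀, rfl⟩
      rw [hφ] at h1 h2
      simp only [hw0, mul_zero, Finset.sum_const_zero] at h1 h2
      linarith
    have hcs : c * W ≤ s := by
      refine le_of_forall_pos_lt_add fun δ hδ => ?_
      have h1 := hs1 (fun _ => c - δ / W) fun _ _ => by
        simp only [mem_Iio]
        have := div_pos hδ hWpos
        linarith
      rw [hconst, sub_mul, div_mul_cancel₀ _ hWpos.ne'] at h1
      linarith
    let g : C(X, ℝ) := ∑ i : u, (w i / W) • (i.1 : C(X, ℝ))
    have hg : g ∈ lipBall X := convex_lipBall.sum_mem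
      (fun i _ => div_nonneg (hw i) hWpos.le)
      (by rw [← Finset.sum_div, div_self hWpos.ne']) fun i _ => i.1.2
    obtain ⟨ν, hν, hlt⟩ := hcon g hg
    have hE : (expectation ν g - expectation μ g) * W = φ (Φ ν) := by
      rw [hφ]
      simp only [g, map_sum, map_smul, smul_eq_mul]
      rw [← Finset.sum_sub_distrib, Finset.sum_mul]
      refine Finset.sum_congr rfl fun i _ => ?_
      simp only [Φ]
      field_simp
    have := hs2 _ ⟨ν, hν, rfl⟩
    have h3 : φ (Φ ν) < c * W := by
      rw [← hE]
      exact mul_lt_mul_of_pos_right hlt hWpos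
    exact absurd (h3.trans_le (hcs.trans this)) (lt_irrefl _)
  obtain ⟨ν, hν, hle⟩ := key
  simp only [mem_iInter] at hle
  refine (hc ν hν).not_ge (KRdist_le fun f hf => ?_)
  have := hle ⟨-f, neg_mem_lipBall hf⟩
  simp only [map_neg, mem_ofPred_eq] at this
  linarith

/-- Pairs of a continuous function `d` (playing the role of the distance to a set `M`) and a
family of bets `g` which wins by a definite amount against every `μ` with `ε ≤ d μ`. -/
def robustBets (X : Type*) [MetricSpace X] [CompactSpace X] [MeasurableSpace X] [BorelSpace X]
    (ε : ℝ) : Set (C(ProbabilityMeasure X, ℝ) × C(ProbabilityMeasure X, C(X, ℝ))) :=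
  {q | ‖q.2‖ < 1 ∧ ∀ μ ν, ε ≤ q.1 μ → q.1 ν = 0 →
    q.1 μ / 2 < expectation ν (q.2 μ) - expectation μ (q.2 μ)}

theorem isOpen_robustBets (ε : ℝ) : IsOpen (robustBets X ε) := by
  rw [robustBets, ofPred_and]
  refine IsOpen.inter (isOpen_lt ((continuous_norm
    (E := C(ProbabilityMeasure X, C(X, ℝ)))).comp continuous_snd) continuous_const) ?_
  rw [← isClosed_compl_iff]
  let T : Set ((C(ProbabilityMeasure X, ℝ) × C(ProbabilityMeasure X, C(X, ℝ))) ×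
      (ProbabilityMeasure X × ProbabilityMeasure X)) :=
    {z | ε ≤ z.1.1 z.2.1 ∧ z.1.1 z.2.2 = 0 ∧
      expectation z.2.2 (z.1.2 z.2.1) - expectation z.2.1 (z.1.2 z.2.1) ≤ z.1.1 z.2.1 / 2}
  have hT : IsClosed T := by
    simp only [T, ofPred_and]
    refine (isClosed_le (by fun_prop) (by fun_prop)).inter
      ((isClosed_eq (by fun_prop) (by fun_prop)).inter (isClosed_le ?_ (by fun_prop)))
    exact (Continuous.expectation (by fun_prop) (by fun_prop)).sub
      (Continuous.expectation (by fun_prop) (by fun_prop))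
  convert isClosedMap_fst_of_compactSpace T hT using 1
  ext q
  constructor
  · intro hq
    simp only [mem_compl_iff, mem_ofPred_eq] at hq
    push Not at hq
    obtain ⟨μ, ν, h⟩ := hq
    exact ⟨(q, μ, ν), h, rfl⟩
  · rintro ⟨⟨q, μ, ν⟩, ⟨h1, h2, h3⟩, rfl⟩ hq
    exact h3.not_gt (hq μ ν h1 h2)

theorem exists_mem_robustBets {M : Set (ProbabilityMeasure X)} (hM : IsCompact M)
    (hconv : ConvexPM M) {ε : ℝ} (hε : 0 < ε) :
    ∃ g, ((⟨_, continuous_KRdistSet hM⟩ : C(ProbabilityMeasure X, ℝ)), g) ∈ robustBets X ε := by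
  have hd := continuous_KRdistSet hM
  set d : ProbabilityMeasure X → ℝ := fun μ => KRdistSet dist μ M with hd_def
  let t : ProbabilityMeasure X → Set C(X, ℝ) := fun μ => {f | ‖f‖ < 1 ∧
    ∀ ν, ε ≤ d μ → d ν = 0 → d μ / 2 < expectation ν f - expectation μ f}
  have ht : ∀ μ, Convex ℝ (t μ) := by
    rintro μ f ⟨hf1, hf2⟩ g ⟨hg1, hg2⟩ a b ha hb hab
    refine ⟨?_, fun ν h1 h2 => ?_⟩
    · have := convex_ball (0 : C(X, ℝ)) 1 (mem_ball_zero_iff.2 hf1) (mem_ball_zero_iff.2 hg1)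
        ha hb hab
      exact mem_ball_zero_iff.1 this
    · have := convex_Ioi (𝕜 := ℝ) (d μ / 2) (hf2 ν h1 h2) (hg2 ν h1 h2) ha hb hab
      simp only [mem_Ioi, smul_eq_mul] at this
      simp only [map_add, map_smul, smul_eq_mul]
      linarith
  have hloc : ∀ μ, ∃ f, ∀ᶠ μ' in 𝓝 μ, f ∈ t μ' := by
    intro μ
    rcases lt_or_ge (d μ) ε with hlt | hge
    · refine ⟨0, ?_⟩
      filter_upwards [hd.continuousAt.eventually_lt continuousAt_const hlt] with μ' hμ'
      exact ⟨by simp, fun ν h => absurd hμ' (not_lt.2 h)⟩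
    · have hdpos : 0 < d μ := hε.trans_le hge
      have hne : M.Nonempty := by
        by_contra h
        rw [not_nonempty_iff_eq_empty] at h
        simp [hd_def, KRdistSet_eq, h] at hdpos
      obtain ⟨f, hf, hsep⟩ := exists_separating_mem_lipBall hM hconv (μ := μ) (c := 3 / 4 * d μ)
        fun ν hν => lt_of_lt_of_le (by linarith) (KRdistSet_le μ hν)
      refine ⟨(9 / 10 : ℝ) • f, ?_⟩
      have hcont : Continuous fun μ' => 27 / 40 * d μ + expectation μ ((9 / 10 : ℝ) • f) -
          expectation μ' ((9 / 10 : ℝ) • f) - d μ' / 2 :=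
        (continuous_const.sub (Continuous.expectation continuous_id continuous_const)).sub
          (hd.div_const 2)
      filter_upwards [continuousAt_const.eventually_lt hcont.continuousAt
        (show (0 : ℝ) < _ by ring_nf; linarith)] with μ' hμ'
      refine ⟨?_, fun ν _ hν => ?_⟩
      · rw [norm_smul, Real.norm_of_nonneg (by norm_num)]
        linarith [norm_le_one_of_mem_lipBall hf]
      · obtain ⟨ν', hν', h0⟩ := exists_KRdist_eq_KRdistSet hM hne ν
        have heq := expectation_eq_of_KRdist_eq_zero (h0.trans hν) hf
        have h1 := hsep ν' hν'
        rw [← heq] at h1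
        simp only [map_smul, smul_eq_mul] at hμ' ⊢
        linarith
  obtain ⟨g, hg⟩ := exists_continuous_forall_mem_convex_of_local_const ht hloc
  refine ⟨g, ?_, fun μ ν h1 h2 => (hg μ).2 ν h1 h2⟩
  exact (ContinuousMap.norm_lt_iff _ zero_lt_one).2 fun μ => (hg μ).1

/-- The bet which plays `g` with stake `max (d - ε) 0`. -/
noncomputable def stakedBet (ε : ℝ) (d : C(ProbabilityMeasure X, ℝ))
    (g : C(ProbabilityMeasure X, C(X, ℝ))) : C(ProbabilityMeasure X × X, ℝ) :=
  ((⟨fun t : ℝ => max (t - ε) 0, by fun_prop⟩ : C(ℝ, ℝ)).comp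
    (d.comp ContinuousMap.fst)) * g.uncurry

theorem stakedBet_apply (ε : ℝ) (d : C(ProbabilityMeasure X, ℝ))
    (g : C(ProbabilityMeasure X, C(X, ℝ))) (μ : ProbabilityMeasure X) (x : X) :
    stakedBet ε d g (μ, x) = max (d μ - ε) 0 * g μ x := rfl

theorem continuous_stakedBet (ε : ℝ) (g : C(ProbabilityMeasure X, C(X, ℝ))) :
    Continuous fun d => stakedBet ε d g :=
  ((ContinuousMap.continuous_postcomp _).comp (ContinuousMap.continuous_precomp _)).mul
    continuous_const

theorem isSavvy_stakedBet {M : Set (ProbabilityMeasure X)} {ε : ℝ}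
    {d : C(ProbabilityMeasure X, ℝ)} (hd : ∀ μ, d μ = KRdistSet dist μ M)
    {g : C(ProbabilityMeasure X, C(X, ℝ))} (hg : (d, g) ∈ robustBets X ε) :
    IsSavvy dist M ε fun p => stakedBet ε d g p := by
  refine ⟨ContinuousMap.continuous _, fun μ => ⟨fun x => ?_, fun ν hν => ?_⟩⟩
  · simp only [stakedBet_apply]
    rw [← hd, abs_mul, abs_of_nonneg (le_max_right _ _)]
    refine mul_le_of_le_one_right (le_max_right _ _) ?_
    exact ((g μ).norm_coe_le_norm x).trans ((g.norm_coe_le_norm μ).trans hg.1.le)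
  · simp only [stakedBet_apply, integral_const_mul, ← hd]
    have h0 : 0 ≤ d μ := by rw [hd]; exact KRdistSet_nonneg μ M
    rcases le_or_gt ε (d μ) with h | h
    · have := hg.2 μ ν h (by rw [hd]; exact KRdistSet_eq_zero_of_mem hν)
      simp only [expectation_apply] at this
      rw [max_eq_left (by linarith)]
      nlinarith
    · rw [max_eq_right (by linarith)]
      nlinarith

theorem measurable_KRdistSet {Y : Type*} [TopologicalSpace Y] [MeasurableSpace Y] [BorelSpace Y]
    {MM : Y → Set (ProbabilityMeasure X)}
    (hclosed : IsClosed {p : Y × ProbabilityMeasure X | p.2 ∈ MM p.1})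
    (hM : ∀ y, IsCompact (MM y)) (μ : ProbabilityMeasure X) :
    Measurable fun y => KRdistSet dist μ (MM y) := by
  refine measurable_of_Iic fun c => ?_
  have hA : MeasurableSet {y | (MM y).Nonempty} := by
    refine IsClosed.measurableSet ?_
    convert isClosedMap_fst_of_compactSpace _ hclosed using 1
    ext y
    exact ⟨fun ⟨ν, hν⟩ => ⟨(y, ν), hν, rfl⟩, by rintro ⟨⟨y, ν⟩, hν, rfl⟩; exact ⟨ν, hν⟩⟩
  have hB : MeasurableSet {y | ∃ ν ∈ MM y, KRdist dist μ ν ≤ c} := by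
    have hcl : IsClosed ({p : Y × ProbabilityMeasure X | p.2 ∈ MM p.1} ∩
        {p | KRdist dist μ p.2 ≤ c}) :=
      hclosed.inter (isClosed_le
        (continuous_KRdist.comp (continuous_const.prodMk continuous_snd)) continuous_const)
    refine IsClosed.measurableSet ?_
    convert isClosedMap_fst_of_compactSpace _ hcl using 1
    ext y
    exact ⟨fun ⟨ν, hν, h⟩ => ⟨(y, ν), ⟨hν, h⟩, rfl⟩,
      by rintro ⟨⟨y, ν⟩, ⟨hν, h⟩, rfl⟩; exact ⟨ν, hν, h⟩⟩
  have : (fun y => KRdistSet dist μ (MM y)) ⁻¹' Iic c =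
      {y | ∃ ν ∈ MM y, KRdist dist μ ν ≤ c} ∪ ({y | (MM y).Nonempty}ᶜ ∩ {_y | 0 ≤ c}) := by
    ext y
    simp only [mem_preimage, mem_Iic, mem_union, mem_inter_iff, mem_compl_iff, mem_ofPred_eq]
    rcases (MM y).eq_empty_or_nonempty with h | h
    · simp [h, KRdistSet_eq]
    · simp only [h, not_true_eq_false, false_and, or_false]
      refine ⟨fun hle => ?_, fun ⟨ν, hν, hle⟩ => (KRdistSet_le μ hν).trans hle⟩
      obtain ⟨ν, hν, heq⟩ := exists_KRdist_eq_KRdistSet (hM y) h μ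
      exact ⟨ν, hν, heq.trans_le hle⟩
  rw [this]
  exact hB.union (hA.compl.inter (MeasurableSet.const _))

end KantorovichRubinstein

/-- Lemma 5.1 of the paper: given a closed-graph, convex-valued family
`MM : Y → 2^{P(X)}`, there is a universally measurable selection of `(MM(y), ε)`-savvy
bets. -/
theorem statement16 {X Y : Type*} [MetricSpace X] [CompactSpace X]
    [MeasurableSpace X] [BorelSpace X]
    [TopologicalSpace Y] [CompactSpace Y] [PolishSpace Y] [MeasurableSpace Y] [BorelSpace Y]
    (MM : Y → Set (ProbabilityMeasure X))
    (hclosed : IsClosed {p : Y × ProbabilityMeasure X | p.2 ∈ MM p.1})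
    (hconv : ∀ y, ConvexPM (MM y)) (ε : ℝ) (hε : 0 < ε) :
    ∃ S : Y → C(ProbabilityMeasure X × X, ℝ),
      @Measurable _ _ (univMS Y) inferInstance S ∧
      ∀ y, IsSavvy dist (MM y) ε (fun p => S y p) := by
  have : SecondCountableTopology (ProbabilityMeasure X) := by
    let _ := TopologicalSpace.metrizableSpaceMetric (ProbabilityMeasure X)
    infer_instance
  have hM : ∀ y, IsCompact (MM y) := fun y =>
    (hclosed.preimage (Continuous.prodMk_right y)).isCompact
  let d : Y → C(ProbabilityMeasure X, ℝ) := fun y => ⟨_, continuous_KRdistSet (hM y)⟩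
  have hd : Measurable d := ContinuousMap.measurable_of_measurable_eval fun μ =>
    measurable_KRdistSet hclosed hM μ
  let g : ℕ → C(ProbabilityMeasure X, C(X, ℝ)) := TopologicalSpace.denseSeq _
  have hex : ∀ y, ∃ n, (d y, g n) ∈ robustBets X ε := fun y =>
    (TopologicalSpace.denseRange_denseSeq _).exists_mem_open
      ((isOpen_robustBets ε).preimage (Continuous.prodMk_right (d y)))
      (exists_mem_robustBets (hM y) (hconv y) hε)
  classical
  refine ⟨fun y => stakedBet ε (d y) (g (Nat.find (hex y))), ?_,
    fun y => isSavvy_stakedBet (fun _ => rfl) (Nat.find_spec (hex y))⟩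
  refine Measurable.mono (Measurable.find (f := fun n y => stakedBet ε (d y) (g n))
    (fun n => (continuous_stakedBet ε (g n)).measurable.comp hd) (fun n => ?_) hex)
    (le_univMS Y) le_rfl
  exact hd (((isOpen_robustBets ε).preimage (Continuous.prodMk_left (g n))).measurableSet)
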